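/- Let A be a Noetherian integral domain with fraction field K which is Cohen–Macaulay (the localization of A at every maximal ideal is a Cohen–Macaulay local ring). Let I be an ideal of A generated by b₀ = f, b₁, …, b_s with f ≠ 0, and suppose the affine modification A ↪ A' = A[I/f] is Davis with this representative system: the kernel of the A-algebra homomorphism β : A[y₁, …, y_s] → K, y_i ↦ b_i/f, equals the ideal J' generated by the elements f·y_i − b_i (so A' ≅ A[y₁, …, y_s]/J'). Then A' is also Cohen–Macaulay: the localization of A' at every maximal ideal is a Cohen–Macaulay local ring. -/

import Mathlib

/-- The affine modification `B[J/g]` of a domain `B` inside a field `K` containing `B`: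
the `B`-subalgebra of `K` generated by the fractions `b/g` with `b ∈ J`. -/
def affineModification (B K : Type*) [CommRing B] [Field K] [Algebra B K]
    (J : Ideal B) (g : B) : Subalgebra B K :=
  Algebra.adjoin B ((fun b => algebraMap B K b / algebraMap B K g) '' (J : Set B))

/-- The ideal `J'` of the polynomial ring `B[y₁, …, y_s]` generated by the elements
`L_i = f·y_i − c_i`. -/
noncomputable def davisIdeal (B : Type*) [CommRing B] (s : ℕ) (f : B) (c : Fin s → B) :
    Ideal (MvPolynomial (Fin s) B) :=
  Ideal.span (Set.range fun i : Fin s =>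
    MvPolynomial.C f * MvPolynomial.X i - MvPolynomial.C (c i))

/-- The `B`-algebra homomorphism `β : B[y₁, …, y_s] → K`, `y_i ↦ c_i/f`, whose image is
the affine modification `B[c₁/f, …, c_s/f] ⊆ K`. -/
noncomputable def davisHom (B K : Type*) [CommRing B] [Field K] [Algebra B K] (s : ℕ)
    (f : B) (c : Fin s → B) : MvPolynomial (Fin s) B →ₐ[B] K :=
  MvPolynomial.aeval fun i => algebraMap B K (c i) / algebraMap B K f

/-- A (Noetherian) local ring is Cohen–Macaulay if its depth equals its Krull dimension,
i.e. there is a regular sequence in the maximal ideal whose length is the Krull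
dimension of the ring. -/
def IsCMLocalRing (R : Type*) [CommRing R] [IsLocalRing R] : Prop :=
  ∃ rs : List R, (∀ r ∈ rs, r ∈ IsLocalRing.maximalIdeal R) ∧
    RingTheory.Sequence.IsRegular R rs ∧ ringKrullDim R = rs.length

/-- A commutative ring is Cohen–Macaulay if its localization at every maximal ideal is a
Cohen–Macaulay local ring. -/
def IsCMRing (R : Type*) [CommRing R] : Prop :=
  ∀ (M : Ideal R) (hM : M.IsMaximal),
    haveI := hM.isPrime
    IsCMLocalRing (Localization.AtPrime M)



open IsLocalRing RingTheory.Sequence in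
/-- Cutting down by a regular element lowers the length of a regular sequence by at most one. -/
lemma exists_isRegular_quotSMulTop.{u} {R : Type u} [CommRing R] [IsLocalRing R]
    [IsNoetherianRing R] {M : Type u} [AddCommGroup M] [Module R M] [Module.Finite R M] {x : R}
    (hx : x ∈ maximalIdeal R) (hreg : IsSMulRegular M x) {rs : List R}
    (hrs : ∀ r ∈ rs, r ∈ maximalIdeal R) (h : IsRegular M rs) :
    ∃ ys : List R, (∀ r ∈ ys, r ∈ maximalIdeal R) ∧ IsRegular (QuotSMulTop x M) ys ∧
      rs.length ≤ ys.length + 1 := by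
  have : Nontrivial M := h.nontrivial
  have hlt : ∀ (N : Type u) [AddCommGroup N] [Module R N] [Module.Finite R N] [Nontrivial N],
      maximalIdeal R • (⊤ : Submodule R N) < ⊤ := fun N _ _ _ _ ↦
    (Submodule.top_ne_ideal_smul_of_le_jacobson_annihilator
      (maximalIdeal_le_jacobson _)).symm.lt_top
  have : Nontrivial (QuotSMulTop x M) := nontrivial_quotSMulTop_of_mem_maximalIdeal M hx
  let N := ModuleCat.of R (R ⧸ maximalIdeal R)
  have hsupp : Module.support R N = PrimeSpectrum.zeroLocus (maximalIdeal R) := by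
    simp [N, Module.support_eq_zeroLocus, Ideal.annihilator_quotient]
  have hExt := ModuleCat.subsingleton_ext_of_exists_isRegular (maximalIdeal R) N hsupp.subset
    (ModuleCat.of R M) (hlt M) rs hrs h
  obtain ⟨ys, hlen, hys, hys'⟩ := ModuleCat.exists_isRegular_of_exists_subsingleton_ext
    (maximalIdeal R) (rs.length - 1) (ModuleCat.of R (QuotSMulTop x M)) (hlt _) N hsupp <| by
      intro i hi
      have zero1 := AddCommGrpCat.isZero_of_iff_subsingleton.mpr (hExt i (by omega))
      have zero2 := AddCommGrpCat.isZero_of_iff_subsingleton.mpr (hExt (i + 1) (by omega))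
      exact AddCommGrpCat.subsingleton_of_isZero <|
        CategoryTheory.ShortComplex.Exact.isZero_of_both_zeros
        ((CategoryTheory.Abelian.Ext.covariant_sequence_exact₃' N
          (IsSMulRegular.smulShortComplex_shortExact (M := ModuleCat.of R M) hreg)) i (i + 1) rfl)
        (zero1.eq_zero_of_src _) (zero2.eq_zero_of_tgt _)
  exact ⟨ys, hys, hys', by omega⟩

open IsLocalRing RingTheory.Sequence in
lemma exists_isRegular_quotient_ofList.{u} {R : Type u} [CommRing R] [IsLocalRing R]
    [IsNoetherianRing R] (rs : List R) {M : Type u} [AddCommGroup M] [Module R M]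
    [Module.Finite R M] (hrs : ∀ r ∈ rs, r ∈ maximalIdeal R) (h : IsRegular M rs) {xs : List R}
    (hxs : ∀ r ∈ xs, r ∈ maximalIdeal R) (h' : IsRegular M xs) :
    ∃ ys : List R, (∀ r ∈ ys, r ∈ maximalIdeal R) ∧
      IsRegular (M ⧸ (Ideal.ofList rs • ⊤ : Submodule R M)) ys ∧
      xs.length ≤ ys.length + rs.length := by
  induction rs generalizing M xs with
  | nil =>
    refine ⟨xs, hxs, ?_, by simp⟩
    refine ((Submodule.quotEquivOfEqBot _ ?_).isRegular_congr xs).mpr h'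
    rw [Ideal.ofList_nil, Submodule.bot_smul]
  | cons x rs ih =>
    rw [isRegular_cons_iff] at h
    simp only [List.mem_cons, forall_eq_or_imp] at hrs
    obtain ⟨zs, hzs, hz, hlen⟩ := exists_isRegular_quotSMulTop hrs.1 h.1 hxs h'
    obtain ⟨ys, hys, hy, hlen'⟩ := ih hrs.2 h.2 hzs hz
    refine ⟨ys, hys, ?_, by simp; omega⟩
    exact ((Submodule.quotOfListConsSMulTopEquivQuotSMulTopInner M x rs).isRegular_congr ys).mpr hy

lemma Ideal.ringKrullDim_quotient_add_one_le_of_lt {R : Type*} [CommRing R] {p q : Ideal R}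
    [p.IsPrime] (h : p < q) : ringKrullDim (R ⧸ q) + 1 ≤ ringKrullDim (R ⧸ p) := by
  obtain ⟨x, hxq, hxp⟩ := SetLike.exists_of_lt h
  refine ringKrullDim_succ_le_of_surjective (Ideal.Quotient.factor h.le)
    (Ideal.Quotient.factor_surjective h.le) (r := Ideal.Quotient.mk p x) ?_ ?_
  · exact mem_nonZeroDivisors_of_ne_zero (by rwa [Ne, Ideal.Quotient.eq_zero_iff_mem])
  · simpa [Ideal.Quotient.eq_zero_iff_mem] using hxq

/-- For a prime `p`, `ht p + dim R/p ≤ dim R`. -/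
lemma Ideal.height_add_ringKrullDim_quotient_le {R : Type*} [CommRing R] (p : Ideal R)
    [hp : p.IsPrime] : (p.height : WithBot ℕ∞) + ringKrullDim (R ⧸ p) ≤ ringKrullDim R := by
  have h : PrimeSpectrum.zeroLocus (p : Set R) = Set.Ici (⟨p, hp⟩ : PrimeSpectrum R) := by
    ext q
    rfl
  have : Nonempty (PrimeSpectrum R) := ⟨⟨p, hp⟩⟩
  have hht : p.height = Order.height (⟨p, hp⟩ : PrimeSpectrum R) :=
    PrimeSpectrum.height_eq_orderHeight ⟨p, hp⟩
  rw [ringKrullDim_quotient, h, ← Order.coheight_eq_krullDim_Ici, hht, ringKrullDim,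
    Order.krullDim_eq_iSup_height_add_coheight_of_nonempty]
  exact_mod_cast le_iSup (fun a : PrimeSpectrum R ↦ Order.height a + Order.coheight a) ⟨p, hp⟩

open IsLocalRing RingTheory.Sequence Pointwise in
/-- A regular sequence is at most as long as the dimension of `R/p` for any associated prime `p`. -/
lemma IsAssociatedPrime.length_le_ringKrullDim_quotient {R : Type*} [CommRing R] [IsLocalRing R]
    [IsNoetherianRing R] (rs : List R) {M : Type*} [AddCommGroup M] [Module R M]
    [Module.Finite R M] {p : Ideal R} (hp : IsAssociatedPrime p M)
    (hrs : ∀ r ∈ rs, r ∈ maximalIdeal R) (h : IsRegular M rs) :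
    (rs.length : WithBot ℕ∞) ≤ ringKrullDim (R ⧸ p) := by
  induction rs generalizing M p with
  | nil =>
    have := hp.isPrime
    simpa using ringKrullDim_nonneg_of_nontrivial
  | cons x rs ih =>
    rw [isRegular_cons_iff] at h
    simp only [List.mem_cons, forall_eq_or_imp] at hrs
    have hprime := hp.isPrime
    obtain ⟨-, z, hz⟩ := isAssociatedPrime_iff.mp hp
    have hpz : ∀ r, r ∈ p ↔ r • z = 0 := fun r ↦ by
      rw [hz, Submodule.mem_colon_singleton, Submodule.mem_bot]
    have hz0 : z ≠ 0 := fun h0 ↦ hprime.ne_top ((Ideal.eq_top_iff_one _).mpr (by simp [hpz, h0]))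
    have hxp : x ∉ p := fun hx ↦ hz0 (h.1 (by simpa using (hpz x).mp hx))
    let N : Submodule R M := Submodule.torsionBySet R M p
    have hN : ¬ N ≤ x • (⊤ : Submodule R M) := by
      intro hle
      refine hz0 ?_
      have hbot : N = ⊥ := by
        refine Submodule.eq_bot_of_le_smul_of_le_jacobson_bot (Ideal.span {x}) N
          (IsNoetherian.noetherian N) ?_ ?_
        · intro n hn
          obtain ⟨m, -, rfl⟩ := (Submodule.mem_smul_pointwise_iff_exists _ _ _).mp (hle hn)
          refine Submodule.smul_mem_smul (Ideal.mem_span_singleton_self x) ?_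
          rw [Submodule.mem_torsionBySet_iff] at hn ⊢
          intro a
          refine h.1 ?_
          simpa [smul_comm x] using hn a
        · rw [Ideal.span_singleton_le_iff_mem, IsLocalRing.jacobson_eq_maximalIdeal _ bot_ne_top]
          exact hrs.1
      have : z ∈ N := (Submodule.mem_torsionBySet_iff _ _).mpr fun a ↦ (hpz a).mp a.2
      simpa [hbot] using this
    obtain ⟨n, hn, hnx⟩ := SetLike.not_le_iff_exists.mp hN
    rw [Submodule.mem_torsionBySet_iff] at hn
    obtain ⟨q, hq, hle⟩ := exists_le_isAssociatedPrime_of_isNoetherianRing R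
      (Submodule.Quotient.mk n : QuotSMulTop x M) (by rwa [Ne, Submodule.Quotient.mk_eq_zero])
    have hmem : ∀ r : R, r • n ∈ x • (⊤ : Submodule R M) → r ∈ q := fun r hr ↦ hle <| by
      rwa [Submodule.mem_colon_singleton, Submodule.mem_bot, ← Submodule.Quotient.mk_smul,
        Submodule.Quotient.mk_eq_zero]
    have hlt : p < q := by
      refine lt_of_le_of_ne (fun a ha ↦ hmem a ?_) fun heq ↦ hxp (heq ▸ hmem x ?_)
      · rw [hn ⟨a, ha⟩]
        exact zero_mem _
      · exact Submodule.smul_mem_pointwise_smul _ _ _ trivial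
    refine le_trans ?_ (Ideal.ringKrullDim_quotient_add_one_le_of_lt hlt)
    rw [List.length_cons, Nat.cast_add, Nat.cast_one]
    exact add_le_add_left (ih hq hrs.2 h.2) 1

open IsLocalRing RingTheory.Sequence in
lemma IsCMLocalRing.of_le {R : Type*} [CommRing R] [IsLocalRing R] [IsNoetherianRing R]
    {rs : List R} (hrs : ∀ r ∈ rs, r ∈ maximalIdeal R) (h : IsWeaklyRegular R rs)
    (hdim : ringKrullDim R ≤ rs.length) : IsCMLocalRing R := by
  have hreg : IsRegular R rs := .of_isWeaklyRegular_of_mem_maximalIdeal R hrs h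
  refine ⟨rs, hrs, hreg, le_antisymm hdim ?_⟩
  have : Nontrivial (R ⧸ Ideal.ofList rs) := Ideal.Quotient.nontrivial_iff.mpr
    fun htop ↦ hreg.top_ne_smul (by simp [htop])
  rw [← ringKrullDim_add_length_eq_ringKrullDim_of_isRegular rs hreg]
  exact le_add_of_nonneg_left ringKrullDim_nonneg_of_nontrivial

open IsLocalRing RingTheory.Sequence in
lemma IsCMLocalRing.of_ringEquiv {R S : Type*} [CommRing R] [IsLocalRing R] [IsNoetherianRing R]
    [CommRing S] [IsLocalRing S] (e : R ≃+* S) (h : IsCMLocalRing R) : IsCMLocalRing S := by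
  have := isNoetherianRing_of_ringEquiv R e
  obtain ⟨rs, hrs, hreg, hdim⟩ := h
  refine .of_le (rs := rs.map e) ?_ ?_ ?_
  · simp only [List.mem_map, forall_exists_index, and_imp, forall_apply_eq_imp_iff₂]
    intro r hr
    simpa [mem_maximalIdeal, mem_nonunits_iff] using hrs r hr
  · refine (e.toAddEquiv.isWeaklyRegular_congr ?_).mp hreg.toIsWeaklyRegular
    exact List.forall₂_map_right_iff.mpr (List.forall₂_same.mpr fun r _ x ↦ by simp)
  · rw [List.length_map, ← hdim, ringKrullDim_eq_of_ringEquiv e]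

open IsLocalRing RingTheory.Sequence in
/-- In a Cohen–Macaulay local ring, the quotient by a regular sequence of length `r` is
equidimensional without embedded primes: `dim R ≤ dim R/p + r` for its associated primes `p`. -/
lemma IsCMLocalRing.ringKrullDim_le_of_isAssociatedPrime {R : Type*} [CommRing R] [IsLocalRing R]
    [IsNoetherianRing R] (hR : IsCMLocalRing R) {rs : List R}
    (hrs : ∀ r ∈ rs, r ∈ maximalIdeal R) (h : IsRegular R rs) {p : Ideal R}
    (hp : IsAssociatedPrime p (R ⧸ (Ideal.ofList rs • ⊤ : Ideal R))) :
    ringKrullDim R ≤ ringKrullDim (R ⧸ p) + rs.length := by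
  obtain ⟨xs, hxs, hx, hdim⟩ := hR
  obtain ⟨ys, hys, hy, hlen⟩ := exists_isRegular_quotient_ofList rs hrs h hxs hx
  calc ringKrullDim R ≤ (ys.length : WithBot ℕ∞) + rs.length := by
        rw [hdim]; exact_mod_cast hlen
    _ ≤ _ := add_le_add_left (hp.length_le_ringKrullDim_quotient ys hys hy) _

lemma IsAssociatedPrime.le_of_quotient {R : Type*} [CommRing R] {I p : Ideal R}
    (hp : IsAssociatedPrime p (R ⧸ I)) : I ≤ p := by
  obtain ⟨-, z, rfl⟩ := hp
  refine le_trans (fun a ha ↦ ?_) Ideal.le_radical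
  rw [Submodule.mem_colon_singleton, Submodule.mem_bot]
  obtain ⟨z, rfl⟩ := Ideal.Quotient.mk_surjective z
  rw [Algebra.smul_def, Ideal.Quotient.algebraMap_eq, Ideal.Quotient.eq_zero_iff_mem.mpr ha,
    zero_mul]

/-- An element avoiding the associated primes of a module is regular on it. -/
lemma exists_isAssociatedPrime_mem_of_not_isSMulRegular {R M : Type*} [CommRing R]
    [IsNoetherianRing R] [AddCommGroup M] [Module R M] {x : R} (hx : ¬ IsSMulRegular M x) :
    ∃ p : Ideal R, IsAssociatedPrime p M ∧ x ∈ p := by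
  have h : x ∈ { r : R | ∃ m : M, m ≠ 0 ∧ r • m = 0 } := by
    by_contra! hc
    refine hx (isSMulRegular_iff_right_eq_zero_of_smul.mpr fun m hm ↦ ?_)
    by_contra hm0
    exact hc ⟨m, hm0, hm⟩
  rw [← biUnion_associatedPrimes_eq_zero_divisors] at h
  simpa [AssociatedPrimes.mem_iff] using h

open IsLocalRing RingTheory.Sequence in
lemma IsCMLocalRing.of_isLocalization {R : Type*} [CommRing R] [IsLocalRing R]
    [IsNoetherianRing R] (hR : IsCMLocalRing R) (p : Ideal R) [hp : p.IsPrime] (S : Type*)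
    [CommRing S] [Algebra R S] [IsLocalization.AtPrime S p] [IsLocalRing S] :
    IsCMLocalRing S := by
  have : IsNoetherianRing S := IsLocalization.isNoetherianRing p.primeCompl S inferInstance
  have hpm : p ≤ maximalIdeal R := le_maximalIdeal hp.ne_top
  obtain ⟨xs, -, -, hxdim⟩ := id hR
  have hreg {rs : List R} (hrs : ∀ r ∈ rs, r ∈ p) (h : IsWeaklyRegular R rs) : IsRegular R rs :=
    .of_isWeaklyRegular_of_mem_maximalIdeal R (fun r hr ↦ hpm (hrs r hr)) h
  have hq {rs : List R} (hrs : ∀ r ∈ rs, r ∈ p) (h : IsWeaklyRegular R rs) :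
      ringKrullDim (R ⧸ Ideal.ofList rs) + rs.length = xs.length := by
    rw [← hxdim, ringKrullDim_add_length_eq_ringKrullDim_of_isRegular rs (hreg hrs h)]
  have hnontriv {rs : List R} (hrs : ∀ r ∈ rs, r ∈ p) : Nontrivial (R ⧸ Ideal.ofList rs) :=
    Ideal.Quotient.nontrivial_iff.mpr
      (ne_top_of_le_ne_top hp.ne_top (Ideal.span_le.mpr fun r hr ↦ hrs r hr))
  have hbound {rs : List R} (hrs : ∀ r ∈ rs, r ∈ p) (h : IsWeaklyRegular R rs) :
      rs.length ≤ xs.length := by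
    have := hnontriv hrs
    have : (rs.length : WithBot ℕ∞) ≤ xs.length := by
      rw [← hq hrs h]
      exact le_add_of_nonneg_left ringKrullDim_nonneg_of_nontrivial
    exact_mod_cast this
  let P : ℕ → Prop := fun n ↦
    ∃ rs : List R, (∀ r ∈ rs, r ∈ p) ∧ IsWeaklyRegular R rs ∧ rs.length = n
  classical
  have hP0 : P 0 := ⟨[], by simp, by simp, rfl⟩
  obtain ⟨rs, hrs, hw, hlen⟩ := Nat.findGreatest_spec (P := P) (Nat.zero_le xs.length) hP0
  have hnonreg : ∀ x ∈ p, ¬ IsSMulRegular (R ⧸ (Ideal.ofList rs • ⊤ : Ideal R)) x := by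
    intro x hx hxreg
    have hrs' : ∀ r ∈ rs ++ [x], r ∈ p := by
      simp only [List.mem_append, List.mem_singleton]
      rintro r (hr | rfl)
      exacts [hrs r hr, hx]
    have hw' : IsWeaklyRegular R (rs ++ [x]) :=
      (isWeaklyRegular_append_iff R rs [x]).mpr ⟨hw, by simpa using hxreg⟩
    have := Nat.le_findGreatest (P := P) (hbound hrs' hw') ⟨_, hrs', hw', rfl⟩
    rw [← hlen] at this
    simp at this
  obtain ⟨q, hqass, hpq⟩ : ∃ q : Ideal R,
      IsAssociatedPrime q (R ⧸ (Ideal.ofList rs • ⊤ : Ideal R)) ∧ p ≤ q := by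
    have hfin := associatedPrimes.finite R (R ⧸ (Ideal.ofList rs • ⊤ : Ideal R))
    have hsub : (p : Set R) ⊆ ⋃ i ∈ (hfin.toFinset : Set (Ideal R)), (i : Set R) := by
      intro x hx
      obtain ⟨q, hq, hxq⟩ := exists_isAssociatedPrime_mem_of_not_isSMulRegular (hnonreg x hx)
      simp only [Set.mem_iUnion]
      exact ⟨q, hfin.mem_toFinset.mpr hq, hxq⟩
    obtain ⟨q, hq, hle⟩ := (Ideal.subset_union_prime (f := id) ⊤ ⊤
      (fun i hi _ _ ↦ (hfin.mem_toFinset.mp hi).isPrime)).mp hsub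
    exact ⟨q, hfin.mem_toFinset.mp hq, hle⟩
  have := hqass.isPrime
  have hmin : p ∈ (Ideal.ofList rs).minimalPrimes := by
    refine ⟨⟨hp, Ideal.span_le.mpr fun r hr ↦ hrs r hr⟩, ?_⟩
    rintro p' ⟨hp', hle⟩ hp'p
    by_contra hcon
    have hlt : p' < q := lt_of_le_of_ne (hp'p.trans hpq) fun h ↦ hcon (h ▸ hpq)
    have h1 : ringKrullDim (R ⧸ q) + 1 ≤ ringKrullDim (R ⧸ Ideal.ofList rs) :=
      (Ideal.ringKrullDim_quotient_add_one_le_of_lt hlt).trans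
        (ringKrullDim_le_of_surjective _ (Ideal.Quotient.factor_surjective hle))
    have h2 := hR.ringKrullDim_le_of_isAssociatedPrime (fun r hr ↦ hpm (hrs r hr))
      (hreg hrs hw) hqass
    have h3 := hq hrs hw
    rw [hxdim] at h2
    have h4 : 0 ≤ ringKrullDim (R ⧸ q) := ringKrullDim_nonneg_of_nontrivial
    have h5 := (add_le_add_left h1 (rs.length : WithBot ℕ∞)).trans_eq h3
    generalize ringKrullDim (R ⧸ q) = a at h2 h4 h5
    induction a with
    | bot => simp at h4
    | coe a =>
      induction a with
      | top =>
        have h5' : (⊤ : ℕ∞) + 1 + rs.length ≤ xs.length := by exact_mod_cast h5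
        simp at h5'
      | coe a =>
        have h2' : xs.length ≤ a + rs.length := by exact_mod_cast h2
        have h5' : a + 1 + rs.length ≤ xs.length := by exact_mod_cast h5
        omega
  have hht : p.height ≤ rs.length := by
    refine (Ideal.height_le_card_of_mem_minimalPrimes_span_finset (s := rs.toFinset) ?_).trans
      (by exact_mod_cast rs.toFinset_card_le)
    simpa [Ideal.ofList] using hmin
  refine .of_le (rs := rs.map (algebraMap R S)) ?_ ?_ ?_
  · simp only [List.mem_map, forall_exists_index, and_imp, forall_apply_eq_imp_iff₂]
    intro r hr
    exact (IsLocalization.AtPrime.to_map_mem_maximal_iff S p r).mpr (hrs r hr)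
  · exact hw.of_isLocalization S p.primeCompl
  · rw [IsLocalization.AtPrime.ringKrullDim_eq_height p, List.length_map]
    exact_mod_cast hht

lemma IsCMRing.of_isPrime {R : Type*} [CommRing R] [IsNoetherianRing R] (h : IsCMRing R)
    (p : Ideal R) [hp : p.IsPrime] : IsCMLocalRing (Localization.AtPrime p) := by
  obtain ⟨m, hm, hpm⟩ := p.exists_le_maximal hp.ne_top
  have disj : Disjoint (m.primeCompl : Set R) p :=
    Set.disjoint_compl_left_iff_subset.mpr hpm
  let P := p.map (algebraMap R (Localization.AtPrime m))
  have : P.IsPrime := IsLocalization.isPrime_of_isPrime_disjoint m.primeCompl _ p hp disj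
  have : IsNoetherianRing (Localization.AtPrime m) :=
    IsLocalization.isNoetherianRing m.primeCompl _ inferInstance
  have : IsNoetherianRing (Localization.AtPrime P) :=
    IsLocalization.isNoetherianRing P.primeCompl _ inferInstance
  have : IsLocalization.AtPrime (Localization.AtPrime P) p := by
    convert IsLocalization.isLocalization_isLocalization_atPrime_isLocalization m.primeCompl
      (Localization.AtPrime P) P
    exact (IsLocalization.under_map_of_isPrime_disjoint m.primeCompl _ hp disj).symm
  exact .of_ringEquiv (IsLocalization.algEquiv p.primeCompl (Localization.AtPrime P)
    (Localization.AtPrime p)).toRingEquiv ((h m hm).of_isLocalization P (Localization.AtPrime P))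

lemma IsCMRing.of_ringEquiv {R S : Type*} [CommRing R] [IsNoetherianRing R] [CommRing S]
    (e : R ≃+* S) (h : IsCMRing R) : IsCMRing S := by
  intro M hM
  have := hM.isPrime
  let m := M.comap e
  have : IsNoetherianRing (Localization.AtPrime m) :=
    IsLocalization.isNoetherianRing m.primeCompl _ inferInstance
  exact .of_ringEquiv (Localization.localRingEquiv m M e rfl) (h.of_isPrime m)

open Polynomial IsLocalRing RingTheory.Sequence in
/-- A monic polynomial is a nonzerodivisor modulo any ideal extended from the base ring. -/
lemma Polynomial.Monic.isSMulRegular_quotient_map_C {R : Type*} [CommRing R] {y : R[X]}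
    (hy : y.Monic) (I : Ideal R) : IsSMulRegular (R[X] ⧸ I.map C) y := by
  rw [isSMulRegular_quotient_iff_mem_of_smul_mem]
  intro g hg
  have hker : I.map C = RingHom.ker (mapRingHom (Ideal.Quotient.mk I)) := by
    rw [ker_mapRingHom, Ideal.mk_ker]
  rw [hker, RingHom.mem_ker] at hg ⊢
  rw [smul_eq_mul, map_mul, coe_mapRingHom] at hg
  exact ((hy.map _).mul_right_eq_zero_iff).mp hg

open Polynomial IsLocalRing RingTheory.Sequence in
lemma IsCMLocalRing.localization_atPrime_polynomial {R : Type*} [CommRing R] [IsLocalRing R]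
    [IsNoetherianRing R] (hR : IsCMLocalRing R) (p : Ideal R[X]) [p.IsPrime]
    (hp : p.comap C = maximalIdeal R) : IsCMLocalRing (Localization.AtPrime p) := by
  have : IsNoetherianRing (Localization.AtPrime p) :=
    IsLocalization.isNoetherianRing p.primeCompl _ inferInstance
  obtain ⟨rs, hrs, hreg, hdim⟩ := hR
  have hle : (maximalIdeal R).map C ≤ p := Ideal.map_le_iff_le_comap.mpr hp.ge
  have hflat : IsWeaklyRegular R[X] (rs.map C) := hreg.toIsWeaklyRegular.of_flat (S := R[X])
  have hmem : ∀ r ∈ rs.map (C : R →+* R[X]), r ∈ p := by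
    simp only [List.mem_map, forall_exists_index, and_imp, forall_apply_eq_imp_iff₂]
    exact fun r hr ↦ hle (Ideal.mem_map_of_mem _ (hrs r hr))
  obtain ⟨ys, hys, hw, hht⟩ : ∃ ys : List R[X], (∀ y ∈ ys, y ∈ p) ∧ IsWeaklyRegular R[X] ys ∧
      (p.height : WithBot ℕ∞) ≤ ys.length := by
    by_cases heq : p = (maximalIdeal R).map C
    · refine ⟨_, hmem, hflat, ?_⟩
      rw [heq, Polynomial.height_map_C, maximalIdeal_height_eq_ringKrullDim, hdim,
        List.length_map]
    · have : (p.comap C).IsMaximal := hp ▸ maximalIdeal.isMaximal R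
      obtain ⟨y, hy, hpy⟩ := Polynomial.exists_monic_span_sup_map_eq R p this
        (by rwa [hp])
      refine ⟨rs.map C ++ [y], ?_, (isWeaklyRegular_append_iff _ _ _).mpr ⟨hflat, ?_⟩, ?_⟩
      · simp only [List.mem_append, List.mem_singleton]
        rintro z (hz | rfl)
        · exact hmem z hz
        · rw [hpy]
          exact Ideal.mem_sup_right (Ideal.mem_span_singleton_self z)
      · rw [isWeaklyRegular_singleton_iff, ← Ideal.map_ofList, smul_eq_mul, Ideal.mul_top]
        exact hy.isSMulRegular_quotient_map_C _
      · refine (Ideal.height_le_ringKrullDim_of_ne_top (Ideal.IsPrime.ne_top')).trans_eq ?_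
        rw [Polynomial.ringKrullDim_of_isNoetherianRing, hdim]
        simp
  refine .of_le (rs := ys.map (algebraMap R[X] _)) ?_ (hw.of_isLocalization _ p.primeCompl) ?_
  · simp only [List.mem_map, forall_exists_index, and_imp, forall_apply_eq_imp_iff₂]
    intro r hr
    exact (IsLocalization.AtPrime.to_map_mem_maximal_iff _ p r).mpr (hys r hr)
  · rwa [IsLocalization.AtPrime.ringKrullDim_eq_height p, List.length_map]

open Polynomial IsLocalRing in
lemma IsCMRing.polynomial {R : Type*} [CommRing R] [IsNoetherianRing R] (h : IsCMRing R) :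
    IsCMRing R[X] := by
  intro p hp
  have hprime := hp.isPrime
  let q := p.comap C
  let S := (Localization.AtPrime q)[X]
  let pc := Submonoid.map Polynomial.C.toMonoidHom q.primeCompl
  let : Algebra R[X] S := Polynomial.algebra R (Localization.AtPrime q)
  have : IsLocalization pc S := Polynomial.isLocalization _ _
  have : IsNoetherianRing (Localization.AtPrime q) :=
    IsLocalization.isNoetherianRing q.primeCompl _ inferInstance
  let pS := p.map (algebraMap R[X] S)
  have disj : Disjoint (pc : Set R[X]) (p : Set R[X]) := by
    simpa [pc, q] using! Set.disjoint_image_left.mpr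
      (Set.disjoint_compl_left_iff_subset.mpr (fun _ a ↦ a))
  have : pS.IsPrime := IsLocalization.isPrime_of_isPrime_disjoint pc _ _ hprime disj
  have : IsNoetherianRing (Localization.AtPrime pS) :=
    IsLocalization.isNoetherianRing pS.primeCompl _ inferInstance
  have : IsLocalization.AtPrime (Localization.AtPrime pS) p := by
    convert IsLocalization.isLocalization_isLocalization_atPrime_isLocalization pc
      (Localization.AtPrime pS) pS
    exact (IsLocalization.under_map_of_isPrime_disjoint pc _ hprime disj).symm
  have eq : pS.comap C = maximalIdeal (Localization.AtPrime q) := by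
    rw [← IsLocalization.map_under q.primeCompl _ (pS.comap C),
      ← IsLocalization.map_under q.primeCompl _ (maximalIdeal (Localization.AtPrime q))]
    simp only [Ideal.comap_comap, S, pS]
    rw [← Polynomial.algebraMap_eq (R := Localization.AtPrime q),
      ← IsScalarTower.algebraMap_eq R (Localization.AtPrime q) (Localization.AtPrime q)[X],
      IsScalarTower.algebraMap_eq R R[X] (Localization.AtPrime q)[X], ← Ideal.comap_comap,
      ← Ideal.under_def R[X], IsLocalization.under_map_of_isPrime_disjoint pc _ hprime disj]
    simp [q, IsLocalization.AtPrime.under_maximalIdeal (Localization.AtPrime q) q]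
  exact .of_ringEquiv (IsLocalization.algEquiv p.primeCompl (Localization.AtPrime pS)
    (Localization.AtPrime p)).toRingEquiv
    ((h.of_isPrime q).localization_atPrime_polynomial pS eq)

lemma IsCMRing.mvPolynomial {R : Type*} [CommRing R] [IsNoetherianRing R] (h : IsCMRing R)
    (n : ℕ) : IsCMRing (MvPolynomial (Fin n) R) := by
  induction n with
  | zero => exact .of_ringEquiv (MvPolynomial.isEmptyRingEquiv R (Fin 0)).symm h
  | succ n ih =>
    exact .of_ringEquiv (MvPolynomial.finSuccEquiv R n).toRingEquiv.symm ih.polynomial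

open IsLocalRing RingTheory.Sequence in
lemma ringKrullDim_quotient_le_ringKrullDim_quotient_append_add_one {R : Type*} [CommRing R]
    [IsLocalRing R] [IsNoetherianRing R] {rs : List R} {x : R}
    (h : ∀ r ∈ rs ++ [x], r ∈ maximalIdeal R) :
    ringKrullDim (R ⧸ Ideal.ofList rs) ≤ ringKrullDim (R ⧸ Ideal.ofList (rs ++ [x])) + 1 := by
  have hle : Ideal.ofList rs ≤ maximalIdeal R :=
    Ideal.span_le.mpr fun r hr ↦ h r (List.mem_append_left _ hr)
  have : Nontrivial (R ⧸ Ideal.ofList rs) :=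
    Ideal.Quotient.nontrivial_iff.mpr (ne_top_of_le_ne_top Ideal.IsPrime.ne_top' hle)
  let π := Ideal.Quotient.mk (Ideal.ofList rs)
  have hπ : Function.Surjective π := Ideal.Quotient.mk_surjective
  have : IsLocalRing (R ⧸ Ideal.ofList rs) := .of_surjective' π hπ
  have hx : π x ∈ Ring.jacobson (R ⧸ Ideal.ofList rs) := by
    rw [ringJacobson_eq_maximalIdeal, ← Ideal.mem_comap,
      eq_maximalIdeal (Ideal.comap_isMaximal_of_surjective π hπ)]
    exact h x (by simp)
  have hdim := ringKrullDim_le_ringKrullDim_quotient_add_card {π x} (by simpa using hx)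
  rw [Finset.card_singleton, Nat.cast_one, Finset.coe_singleton] at hdim
  refine hdim.trans (add_le_add_left (ringKrullDim_le_of_surjective
    (Ideal.Quotient.lift _ ((Ideal.Quotient.mk (Ideal.span {π x})).comp π) fun a ha ↦ ?_)
    (Ideal.Quotient.lift_surjective_of_surjective _ _
      (Ideal.Quotient.mk_surjective.comp hπ))) _)
  rw [← RingHom.mem_ker]
  refine (Ideal.span_le.mpr fun r hr ↦ ?_ : Ideal.ofList (rs ++ [x]) ≤ _) ha
  rw [SetLike.mem_coe, RingHom.mem_ker, RingHom.comp_apply, Ideal.Quotient.eq_zero_iff_mem]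
  rcases List.mem_append.mp hr with hr | hr
  · rw [Ideal.Quotient.eq_zero_iff_mem.mpr (Ideal.subset_span (s := {r | r ∈ rs}) hr)]
    exact zero_mem _
  · rw [List.mem_singleton.mp hr]
    exact Ideal.mem_span_singleton_self _

open IsLocalRing RingTheory.Sequence in
/-- In a Cohen–Macaulay local ring, a sequence cutting the dimension down by its length is
regular. -/
lemma IsCMLocalRing.isWeaklyRegular_of_ringKrullDim_add_le {R : Type*} [CommRing R] [IsLocalRing R]
    [IsNoetherianRing R] (hR : IsCMLocalRing R) (rs : List R)
    (hrs : ∀ r ∈ rs, r ∈ maximalIdeal R)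
    (hdim : ringKrullDim (R ⧸ Ideal.ofList rs) + rs.length ≤ ringKrullDim R) :
    IsWeaklyRegular R rs := by
  induction rs using List.reverseRecOn with
  | nil => simp
  | append_singleton rs x ih =>
    have hrs' : ∀ r ∈ rs, r ∈ maximalIdeal R := fun r hr ↦ hrs r (List.mem_append_left _ hr)
    rw [List.length_append, List.length_singleton, Nat.cast_add, Nat.cast_one] at hdim
    have hw : IsWeaklyRegular R rs := by
      refine ih hrs' (le_trans ?_ hdim)
      rw [add_comm (rs.length : WithBot ℕ∞), ← add_assoc]
      exact add_le_add_left
        (ringKrullDim_quotient_le_ringKrullDim_quotient_append_add_one hrs) _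
    rw [isWeaklyRegular_append_iff, isWeaklyRegular_singleton_iff]
    refine ⟨hw, ?_⟩
    by_contra hx
    obtain ⟨p, hp, hxp⟩ := exists_isAssociatedPrime_mem_of_not_isSMulRegular hx
    have hle : Ideal.ofList (rs ++ [x]) ≤ p := by
      rw [Ideal.ofList_append, Ideal.ofList_singleton, sup_le_iff, Ideal.span_singleton_le_iff_mem]
      exact ⟨(by simpa using hp.le_of_quotient), hxp⟩
    have h1 := hR.ringKrullDim_le_of_isAssociatedPrime hrs'
      (.of_isWeaklyRegular_of_mem_maximalIdeal R hrs' hw) hp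
    have h2 := hdim.trans (h1.trans (add_le_add_left (ringKrullDim_le_of_surjective _
      (Ideal.Quotient.factor_surjective hle)) _))
    have : Nontrivial (R ⧸ Ideal.ofList (rs ++ [x])) :=
      have := hp.isPrime
      Ideal.Quotient.nontrivial_iff.mpr (ne_top_of_le_ne_top (Ideal.IsPrime.ne_top' (I := p)) hle)
    have h3 : 0 ≤ ringKrullDim (R ⧸ Ideal.ofList (rs ++ [x])) := ringKrullDim_nonneg_of_nontrivial
    have h4 : ringKrullDim (R ⧸ Ideal.ofList (rs ++ [x])) < ⊤ :=
      (ringKrullDim_quotient_le _).trans_lt ringKrullDim_lt_top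
    generalize ringKrullDim (R ⧸ Ideal.ofList (rs ++ [x])) = a at h2 h3 h4
    induction a with
    | bot => simp at h3
    | coe a =>
      induction a with
      | top => exact absurd h4 (lt_irrefl _)
      | coe a =>
        have h2' : a + (rs.length + 1) ≤ a + rs.length := by exact_mod_cast h2
        omega

open IsLocalRing RingTheory.Sequence in
lemma IsCMLocalRing.of_surjective.{u} {R : Type u} {S : Type*} [CommRing R] [IsLocalRing R]
    [IsNoetherianRing R] [CommRing S] [IsLocalRing S] (hR : IsCMLocalRing R) (g : R →+* S)
    (hg : Function.Surjective g) (rs : List R) (hker : RingHom.ker g = Ideal.ofList rs)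
    (hdim : ringKrullDim S + rs.length ≤ ringKrullDim R) : IsCMLocalRing S := by
  have : IsNoetherianRing S := isNoetherianRing_of_surjective R S g hg
  have hmax : (maximalIdeal S).comap g = maximalIdeal R :=
    eq_maximalIdeal (Ideal.comap_isMaximal_of_surjective g hg)
  have hrs : ∀ r ∈ rs, r ∈ maximalIdeal R := by
    intro r hr
    have : r ∈ RingHom.ker g := hker ▸ Ideal.subset_span hr
    rw [← hmax, Ideal.mem_comap, RingHom.mem_ker.mp this]
    exact zero_mem _
  have e : (R ⧸ Ideal.ofList rs) ≃+* S :=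
    (Ideal.quotEquivOfEq hker.symm).trans (RingHom.quotientKerEquivOfSurjective hg)
  have hreg : IsRegular R rs := .of_isWeaklyRegular_of_mem_maximalIdeal R hrs
    (hR.isWeaklyRegular_of_ringKrullDim_add_le rs hrs (by rwa [ringKrullDim_eq_of_ringEquiv e]))
  obtain ⟨xs, hxs, hx, hxdim⟩ := hR
  obtain ⟨ys, hys, hy, hlen⟩ := exists_isRegular_quotient_ofList rs hrs hreg hxs hx
  algebraize [g]
  let e' : (R ⧸ (Ideal.ofList rs • ⊤ : Ideal R)) ≃ₗ[R] S :=
    (Submodule.quotEquivOfEq _ (LinearMap.ker (Algebra.linearMap R S))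
      (by ext r; simp [← hker, RingHom.algebraMap_toAlgebra])).trans
      ((Algebra.linearMap R S).quotKerEquivOfSurjective hg)
  refine .of_le (rs := ys.map (algebraMap R S)) ?_ ?_ ?_
  · simp only [List.mem_map, forall_exists_index, and_imp, forall_apply_eq_imp_iff₂]
    intro r hr
    exact Ideal.mem_comap.mp (hmax ▸ hys r hr : r ∈ (maximalIdeal S).comap g)
  · rw [isWeaklyRegular_map_algebraMap_iff]
    exact (e'.isWeaklyRegular_congr ys).mp hy.toIsWeaklyRegular
  · rw [List.length_map]
    rw [hxdim] at hdim
    generalize ringKrullDim S = a at hdim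
    induction a with
    | bot => simp
    | coe a =>
      induction a with
      | top =>
        have hdim' : (⊤ : ℕ∞) + rs.length ≤ xs.length := by exact_mod_cast hdim
        simp at hdim'
      | coe a =>
        have hdim' : a + rs.length ≤ xs.length := by exact_mod_cast hdim
        exact_mod_cast (by omega : a ≤ ys.length)

/-- The image of `β` is the affine modification. -/
lemma range_davisHom {A K : Type*} [CommRing A] [Field K] [Algebra A K] (s : ℕ)
    (b : Fin (s + 1) → A) (hf : algebraMap A K (b 0) ≠ 0) :
    (davisHom A K s (b 0) fun i => b i.succ).range =
      affineModification A K (Ideal.span (Set.range b)) (b 0) := by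
  rw [davisHom, ← Algebra.adjoin_range_eq_range_aeval, affineModification]
  refine le_antisymm (Algebra.adjoin_mono ?_) (Algebra.adjoin_le ?_)
  · rintro _ ⟨i, rfl⟩
    exact ⟨b i.succ, Ideal.subset_span ⟨_, rfl⟩, rfl⟩
  · rintro _ ⟨a, ha, rfl⟩
    simp only [SetLike.mem_coe]
    induction ha using Submodule.span_induction with
    | mem x hx =>
      obtain ⟨i, rfl⟩ := hx
      cases i using Fin.cases with
      | zero =>
        rw [div_self hf]
        exact one_mem _
      | succ i => exact Algebra.subset_adjoin ⟨i, rfl⟩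
    | zero => simp
    | add x y _ _ hx hy =>
      rw [map_add, add_div]
      exact add_mem hx hy
    | smul r x _ hx =>
      rw [smul_eq_mul, map_mul, mul_div_assoc, ← Algebra.smul_def]
      exact Subalgebra.smul_mem _ hx r

open MvPolynomial in
/-- The kernel of `β` has height at least the number of variables. -/
lemma le_height_ker_davisHom {A K : Type*} [CommRing A] [Field K] [Algebra A K] [FaithfulSMul A K]
    [IsNoetherianRing A] (s : ℕ) {f : A} (hf : f ≠ 0) (c : Fin s → A) :
    (s : ℕ∞) ≤ (RingHom.ker (davisHom A K s f c)).height := by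
  have hf' : algebraMap A K f ≠ 0 := by
    rwa [Ne, FaithfulSMul.algebraMap_eq_zero_iff]
  let φ (n : ℕ) : MvPolynomial (Fin s) A →ₐ[A] MvPolynomial (Fin s) K :=
    aeval fun i ↦ if (i : ℕ) < n then C (algebraMap A K (c i) / algebraMap A K f) else X i
  have hφC (n : ℕ) (a : A) : φ n (C a) = C (algebraMap A K a) := by
    simp [φ, MvPolynomial.algebraMap_apply]
  have hprime (n : ℕ) : (RingHom.ker (φ n)).IsPrime := RingHom.ker_isPrime _
  have hlt (n : ℕ) (hn : n < s) : RingHom.ker (φ n) < RingHom.ker (φ (n + 1)) := by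
    refine lt_of_le_of_ne (fun p hp ↦ ?_) fun heq ↦ ?_
    · let ψ : MvPolynomial (Fin s) K →ₐ[K] MvPolynomial (Fin s) K := aeval fun i ↦
        if (i : ℕ) < n + 1 then C (algebraMap A K (c i) / algebraMap A K f) else X i
      have hψ : φ (n + 1) = (ψ.restrictScalars A).comp (φ n) := by
        refine MvPolynomial.algHom_ext fun i ↦ ?_
        by_cases hi : (i : ℕ) < n
        · simp [φ, ψ, hi, hi.le, MvPolynomial.algebraMap_eq]
        · simp [φ, ψ, hi]
      rw [RingHom.mem_ker] at hp ⊢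
      rw [hψ, AlgHom.comp_apply, hp, map_zero]
    · let i : Fin s := ⟨n, hn⟩
      have hmem : C f * X i - C (c i) ∈ RingHom.ker (φ (n + 1)) := by
        have hX : φ (n + 1) (X i) = C (algebraMap A K (c i) / algebraMap A K f) := by simp [φ, i]
        rw [RingHom.mem_ker, map_sub, map_mul, hφC, hφC, hX, ← C_mul, mul_div_cancel₀ _ hf',
          sub_self]
      have hX : φ n (X i) = X i := by simp [φ, i]
      rw [← heq, RingHom.mem_ker, map_sub, map_mul, hφC, hφC, hX] at hmem
      have hcoeff := congrArg (coeff (Finsupp.single i 1)) hmem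
      have hne : (0 : Fin s →₀ ℕ) ≠ Finsupp.single i 1 := by simp [eq_comm]
      rw [coeff_sub, coeff_C_mul, coeff_X, if_pos rfl, mul_one, coeff_C, if_neg hne, sub_zero,
        coeff_zero] at hcoeff
      exact hf' hcoeff
  have hht (n : ℕ) (hn : n ≤ s) : (n : ℕ∞) ≤ (RingHom.ker (φ n)).height := by
    induction n with
    | zero => simp
    | succ n ih =>
      refine le_trans ?_ (Ideal.height_add_one_le_of_lt_of_isPrime (hlt n hn))
      rw [Nat.cast_add, Nat.cast_one]
      exact add_le_add_left (ih (by omega)) 1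
  convert hht s le_rfl using 2
  ext p
  have : φ s = ((Algebra.ofId K (MvPolynomial (Fin s) K)).restrictScalars A).comp
      (davisHom A K s f c) := by
    refine MvPolynomial.algHom_ext fun i ↦ ?_
    simp [φ, davisHom, Algebra.ofId_apply, algebraMap_eq]
  rw [RingHom.mem_ker, RingHom.mem_ker, this]
  simp [Algebra.ofId_apply]

lemma Localization.ker_localRingHom {R S : Type*} [CommRing R] [CommRing S] [IsDomain S]
    (I : Ideal R) [I.IsPrime] (J : Ideal S) [J.IsPrime] (f : R →+* S) (hIJ : I = J.comap f) :
    RingHom.ker (Localization.localRingHom I J f hIJ) =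
      (RingHom.ker f).map (algebraMap R (Localization.AtPrime I)) := by
  refine le_antisymm (fun z hz ↦ ?_) (Ideal.map_le_iff_le_comap.mpr fun x hx ↦ ?_)
  · obtain ⟨x, y, rfl⟩ := IsLocalization.exists_mk'_eq I.primeCompl z
    rw [RingHom.mem_ker, Localization.localRingHom_mk', IsLocalization.mk'_eq_zero_iff] at hz
    obtain ⟨m, hm⟩ := hz
    have hm0 : (m : S) ≠ 0 := fun h ↦ m.2 (h ▸ zero_mem J)
    rw [IsLocalization.mk'_eq_mul_mk'_one]
    exact Ideal.mul_mem_right _ _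
      (Ideal.mem_map_of_mem _ ((mul_eq_zero_iff_left hm0).mp hm))
  · rw [Ideal.mem_comap, RingHom.mem_ker, Localization.localRingHom_to_map,
      RingHom.mem_ker.mp hx, map_zero]

/-- **Proposition 2.10**: let `A` be a Noetherian Cohen–Macaulay domain with fraction
field `K`, let `I = (b₀ = f, b₁, …, b_s)` with `f ≠ 0`, and suppose the modification
`A ↪ A' = A[I/f]` is Davis with this representative system: the kernel of
`β : A[y₁, …, y_s] → K`, `y_i ↦ b_i/f`, equals the ideal `J'` generated by the
`f·y_i − b_i` (so `A' ≅ A[y₁, …, y_s]/J'`).  Then `A'` is also Cohen–Macaulay. -/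
theorem stmt13 (A K : Type*) [CommRing A] [IsDomain A] [IsNoetherianRing A]
    [Field K] [Algebra A K] [IsFractionRing A K] (hCM : IsCMRing A)
    (s : ℕ) (b : Fin (s + 1) → A) (f : A) (hb0 : b 0 = f) (hf : f ≠ 0)
    (I : Ideal A) (hI : I = Ideal.span (Set.range b))
    (hDavis : RingHom.ker (davisHom A K s f fun i => b i.succ) =
      davisIdeal A s f fun i => b i.succ) :
    IsCMRing ↥(affineModification A K I f) := by
  subst hb0 hI
  have hf' : algebraMap A K (b 0) ≠ 0 := by rwa [Ne, FaithfulSMul.algebraMap_eq_zero_iff]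
  set β := davisHom A K s (b 0) fun i => b i.succ
  let Ls : List (MvPolynomial (Fin s) A) := List.ofFn fun i : Fin s =>
    MvPolynomial.C (b 0) * MvPolynomial.X i - MvPolynomial.C (b i.succ)
  have hkerβ : RingHom.ker β = Ideal.ofList Ls := by
    rw [hDavis, davisIdeal, Ideal.ofList]
    congr 1
    ext
    simp [Ls, List.mem_ofFn]
  obtain ⟨π, hπ, hkerπ⟩ : ∃ π : MvPolynomial (Fin s) A →+*
      affineModification A K (Ideal.span (Set.range b)) (b 0),
      Function.Surjective π ∧ RingHom.ker π = RingHom.ker β := by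
    rw [← range_davisHom s b hf']
    refine ⟨β.rangeRestrict.toRingHom, β.rangeRestrict_surjective, ?_⟩
    ext p
    simp [RingHom.mem_ker, Subtype.ext_iff]
  have hR := hCM.mvPolynomial s
  intro M hM
  have := hM.isPrime
  let Q := M.comap π
  let T := Localization.AtPrime Q
  have : IsNoetherianRing T := IsLocalization.isNoetherianRing Q.primeCompl _ inferInstance
  let g : T →+* Localization.AtPrime M := Localization.localRingHom Q M π rfl
  have hg : Function.Surjective g :=
    (RingHom.surjectiveOnStalks_of_surjective hπ).localRingHom_surjective Q M rfl
  have hkerg : RingHom.ker g = (RingHom.ker π).map (algebraMap _ T) :=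
    Localization.ker_localRingHom Q M π rfl
  refine (hR.of_isPrime Q).of_surjective g hg (Ls.map (algebraMap _ T)) ?_ ?_
  · rw [hkerg, hkerπ, hkerβ, Ideal.map_ofList]
  · have hprimeπ : (RingHom.ker π).IsPrime := RingHom.ker_isPrime π
    have hprimeg : (RingHom.ker g).IsPrime := RingHom.ker_isPrime g
    have hdisj : Disjoint (Q.primeCompl : Set (MvPolynomial (Fin s) A)) (RingHom.ker π) :=
      Set.disjoint_compl_left_iff_subset.mpr (Ideal.comap_mono bot_le)
    have hht : (s : ℕ∞) ≤ (RingHom.ker g).height := by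
      rw [hkerg, IsLocalization.height_map_of_disjoint Q.primeCompl _ hdisj, hkerπ]
      exact le_height_ker_davisHom s hf _
    have hdim : ringKrullDim (T ⧸ RingHom.ker g) = ringKrullDim (Localization.AtPrime M) :=
      ringKrullDim_eq_of_ringEquiv (RingHom.quotientKerEquivOfSurjective hg)
    refine le_trans ?_ (RingHom.ker g).height_add_ringKrullDim_quotient_le
    rw [hdim, add_comm]
    refine add_le_add_left ?_ _
    simpa [Ls] using WithBot.coe_le_coe.mpr hht
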